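/- Let r, s ∈ (−1,1) ⊂ ℝ and p, q ∈ 𝔹, and let f be a slice regular self-map of 𝔹 which is not of the form ℳ_{p'} u with p' ∈ 𝔹 and |u| = 1. Then δ(0, f⋆_r(q)) ≤ δ(0, f⋆_s(p)) + δ(p, r) + δ(q, s), where δ is the Poincaré distance on 𝔹. -/

import Mathlib

noncomputable section

abbrev H : Type := Quaternion ℝ

namespace QPaper

/-- The complex slice determined by `I`: the real span of `1` and `I`. -/
def sliceSet (I : H) : Set H := {q | ∃ x y : ℝ, q = (x : H) + y • I}

/-- Evaluation of the power series `q ↦ ∑ qᵐ aₘ` with right coefficients. -/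
def evalC (a : ℕ → H) (q : H) : H := ∑' m, q ^ m * a m

/-- The series with coefficients `a` converges at every point of the unit ball. -/
def SummableOn (a : ℕ → H) : Prop := ∀ q : H, ‖q‖ < 1 → Summable fun m => q ^ m * a m

/-- `a` are the coefficients of a slice regular self-map of the unit ball. -/
def SelfMap (a : ℕ → H) : Prop :=
  SummableOn a ∧ ∀ q : H, ‖q‖ < 1 → ‖evalC a q‖ < 1

/-- Coefficients of the ∗-product. -/
def starMulC (a b : ℕ → H) : ℕ → H := fun m => ∑ ℓ ∈ Finset.range (m + 1), a (m - ℓ) * b ℓ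

/-- Coefficients of the ∗-inverse (of a series with invertible constant term). -/
def starInvC (a : ℕ → H) : ℕ → H
  | 0 => (a 0)⁻¹
  | m + 1 => -(a 0)⁻¹ * ∑ ℓ : Fin (m + 1), a (m + 1 - ℓ.val) * starInvC a ℓ.val
  decreasing_by exact ℓ.isLt

/-- Coefficients of `1 - q p̄`. -/
def oneMinusQPbarC (p : H) : ℕ → H := fun m => if m = 0 then 1 else if m = 1 then -(star p) else 0

/-- Coefficients of `q - p`. -/
def qMinusPC (p : H) : ℕ → H := fun m => if m = 0 then -p else if m = 1 then 1 else 0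

/-- Coefficients of the regular Möbius transformation `ℳ_p = (1 - q p̄)^{-∗} ∗ (q - p)`. -/
def mobiusC (p : H) : ℕ → H := starMulC (starInvC (oneMinusQPbarC p)) (qMinusPC p)

/-- Coefficients of `ℳ_{t₁} ∗ ⋯ ∗ ℳ_{t_κ}`. -/
def blaschkeListC : List H → (ℕ → H)
  | [] => fun m => if m = 0 then 1 else 0
  | t :: ts => starMulC (mobiusC t) (blaschkeListC ts)

/-- `a` are the coefficients of a regular Blaschke product of degree `κ`,
i.e. of `ℳ_{t₁} ∗ ⋯ ∗ ℳ_{t_κ} u` with the `tᵢ` in `𝔹` and `u` unimodular. -/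
def IsBlaschke (a : ℕ → H) (κ : ℕ) : Prop :=
  ∃ (ts : List H) (u : H), ts.length = κ ∧ (∀ t ∈ ts, ‖t‖ < 1) ∧ ‖u‖ = 1 ∧
    a = fun m => blaschkeListC ts m * u

/-- Coefficients of `ℳ_w ∙ f = (1 - f w̄)^{-∗} ∗ (f - w)`. -/
def bulletC (w : H) (a : ℕ → H) : ℕ → H :=
  starMulC (starInvC (fun m => (if m = 0 then (1 : H) else 0) - a m * star w))
    (fun m => a m - if m = 0 then w else 0)

/-- Coefficients of the regular difference quotient `ℛ_{f,p}`,
the unique slice regular function with `f(q) = f(p) + (q - p) ∗ ℛ_{f,p}(q)`. -/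
def diffQuotC (a : ℕ → H) (p : H) : ℕ → H := fun m => ∑' k, p ^ k * a (k + m + 1)

/-- Coefficients of the hyperbolic difference quotient
`f⋆_p = (1 - q p̄) ∗ ℛ_{f,p} ∗ (1 - \overline{f(p)} f)^{-∗} = ℳ_p^{-∗} ∗ (ℳ_{f(p)} ∙ f)`. -/
def hdqC (a : ℕ → H) (p : H) : ℕ → H :=
  starMulC (starMulC (oneMinusQPbarC p) (diffQuotC a p))
    (starInvC (fun m => (if m = 0 then (1 : H) else 0) - star (evalC a p) * a m))

/-- Iterated hyperbolic difference quotients: `ihdqC a [p₁, …, pₙ] = ((f⋆_{p₁})⋆_{p₂} ⋯)⋆_{pₙ}`. -/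
def ihdqC (a : ℕ → H) : List H → (ℕ → H)
  | [] => a
  | p :: ps => ihdqC (hdqC a p) ps

/-- `𝒯_p(q) = (1 - q p)⁻¹ q (1 - q p)`. -/
def mobiusT (p q : H) : H := (1 - q * p)⁻¹ * q * (1 - q * p)

/-- `M_p(q) = (1 - q p̄)⁻¹ (q - p)`. -/
def mobiusM (p q : H) : H := (1 - q * star p)⁻¹ * (q - p)

/-- Pointwise evaluation of the regular Möbius transformation: `ℳ_p(q) = M_p(𝒯_p(q))`. -/
def mobiusEval (p q : H) : H := mobiusM p (mobiusT p q)

/-- The pseudo-hyperbolic distance `ρ(p,q) = |M_p(q)|`. -/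
def rho (p q : H) : ℝ := ‖mobiusM p q‖

/-- The Poincaré distance `δ(p,q) = tanh⁻¹ ρ(p,q) = ½ log((1+ρ)/(1−ρ))`. -/
def pdist (p q : H) : ℝ := (1/2 : ℝ) * Real.log ((1 + rho p q) / (1 - rho p q))


section Aux1
open PowerSeries

/-- Evaluation of a formal power series. -/
def ev (f : PowerSeries H) (q : H) : H := ∑' m, q ^ m * coeff m f

/-- Twisted evaluation. -/
def tw (f : PowerSeries H) (q v : H) : H := ∑' m, q ^ m * v * coeff m f

/-- Toeplitz contraction property. -/
def Schur (f : PowerSeries H) : Prop :=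
  ∀ (N : ℕ) (x : PowerSeries H), ∑ m ∈ Finset.range N, ‖coeff m (x * f)‖ ^ 2
    ≤ ∑ m ∈ Finset.range N, ‖coeff m x‖ ^ 2

/-- Absolute convergence at radius `t`. -/
def AC (f : PowerSeries H) (t : ℝ) : Prop := Summable fun m => t ^ m * ‖coeff m f‖

theorem evalC_eq (a : ℕ → H) (q : H) : evalC a q = ev (mk a) q := by
  simp [evalC, ev]

theorem mk_starMulC (a b : ℕ → H) : mk (starMulC a b) = mk a * mk b := by
  ext1 n
  rw [coeff_mk, coeff_mul, ← Finset.Nat.sum_antidiagonal_swap,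
    Finset.Nat.sum_antidiagonal_eq_sum_range_succ_mk]
  simp [starMulC]

theorem mk_starInvC (a : ℕ → H) (h : a 0 ≠ 0) : mk a * mk (starInvC a) = 1 := by
  rw [← mk_starMulC]
  ext1 n
  rw [coeff_mk]
  cases n with
  | zero => simp [starMulC, starInvC, h]
  | succ m =>
    rw [starMulC, Finset.sum_range_succ]
    conv_lhs => rw [starInvC.eq_2 a m]
    rw [Finset.sum_range]
    simp [coeff_one, h]

theorem ev_eq_tw (f : PowerSeries H) (q : H) : ev f q = tw f q 1 := by
  simp [ev, tw]

theorem AC.summable_tw {f : PowerSeries H} {q : H} (h : AC f ‖q‖) (v : H) :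
    Summable fun m => q ^ m * v * coeff m f := by
  apply Summable.of_norm
  have := h.mul_left ‖v‖
  refine this.congr ?_
  intro m
  simp only [norm_mul, norm_pow]; ring

theorem ev_mul {x f : PowerSeries H} {q : H} (hx : AC x ‖q‖) (hf : AC f ‖q‖) :
    (Summable fun m => q ^ m * coeff m (x * f)) ∧ ev (x * f) q = tw f q (ev x q) := by
  set u : ℕ × ℕ → H := fun p => q ^ (p.1 + p.2) * (coeff p.1 x * coeff p.2 f) with hu
  have hsum : Summable u := by
    apply Summable.of_norm
    have := Summable.mul_of_nonneg hx hf (fun m => by positivity) (fun m => by positivity)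
    refine this.congr ?_
    intro p
    simp only [hu, norm_mul, norm_pow, pow_add]; ring
  have h1 : ∑' p, u p = tw f q (ev x q) := by
    rw [← (Equiv.prodComm ℕ ℕ).tsum_eq u]
    rw [Summable.tsum_prod (by exact ((Equiv.prodComm ℕ ℕ).summable_iff (f := u)).2 hsum)]
    unfold tw
    congr 1; ext1 j
    have hs : Summable fun m => q ^ m * coeff m x := by
      have := hx.summable_tw 1
      simpa using this
    rw [mul_assoc, ev, ← hs.tsum_mul_right, ← (hs.mul_right _).tsum_mul_left]
    congr 1; ext1 i
    simp only [hu, Equiv.prodComm_apply, Prod.swap, pow_add]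
    rw [(Commute.refl q).pow_pow i j |>.eq]
    simp only [mul_assoc]
  have hs2 : Summable fun x : Σ n : ℕ, Finset.HasAntidiagonal.antidiagonal n => u (x.2 : ℕ × ℕ) :=
    (Finset.HasAntidiagonal.sigmaAntidiagonalEquivProd (A := ℕ)).summable_iff.2 hsum
  have key : ∀ n, q ^ n * coeff n (x * f) = ∑' b : Finset.HasAntidiagonal.antidiagonal n, u b := by
    intro n
    rw [tsum_fintype, Finset.sum_coe_sort _ u, coeff_mul, Finset.mul_sum]
    apply Finset.sum_congr rfl
    intro p hp
    rw [Finset.HasAntidiagonal.mem_antidiagonal] at hp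
    simp [hu, hp]
  constructor
  · simp_rw [key]
    exact hs2.sigma' fun n => (hasSum_fintype _).summable
  · rw [← h1, ← (Finset.HasAntidiagonal.sigmaAntidiagonalEquivProd (A := ℕ)).tsum_eq u]
    unfold ev
    simp_rw [key]
    exact (hs2.tsum_sigma' fun n => (hasSum_fintype _).summable).symm

theorem tw_comm (f : PowerSeries H) (q v : H) (h : Commute q v) : tw f q v = v * ev f q := by
  unfold tw ev
  rw [← tsum_mul_left]
  congr 1; ext1 m
  rw [(h.pow_left m).eq, mul_assoc]

theorem AC_of_bdd {f : PowerSeries H} {B t : ℝ} (hB : ∀ m, ‖coeff m f‖ ≤ B) (h0 : 0 ≤ t)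
    (h1 : t < 1) : AC f t := by
  refine Summable.of_nonneg_of_le (fun m => by positivity) (fun m => ?_)
    ((summable_geometric_of_lt_one h0 h1).mul_right B)
  exact mul_le_mul_of_nonneg_left (hB m) (by positivity)

theorem Schur.sum_le {f : PowerSeries H} (h : Schur f) (N : ℕ) :
    ∑ m ∈ Finset.range N, ‖coeff m f‖ ^ 2 ≤ 1 := by
  have := h N 1
  rw [one_mul] at this
  refine this.trans ?_
  cases N with
  | zero => simp
  | succ n =>
    rw [Finset.sum_range_succ']
    simp [coeff_one]

theorem Schur.bdd {f : PowerSeries H} (h : Schur f) (m : ℕ) : ‖coeff m f‖ ≤ 1 := by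
  have h1 := h.sum_le (m + 1)
  have h2 := Finset.single_le_sum (f := fun m => ‖coeff m f‖ ^ 2)
    (fun i _ => by positivity) (Finset.self_mem_range_succ m)
  have h3 := h2.trans h1
  nlinarith [norm_nonneg (coeff m f)]

theorem Schur.ac {f : PowerSeries H} (h : Schur f) {q : H} (hq : ‖q‖ < 1) : AC f ‖q‖ :=
  AC_of_bdd h.bdd (norm_nonneg _) hq

theorem Schur.tw_le {f : PowerSeries H} (h : Schur f) {q : H} (hq : ‖q‖ < 1) (v : H) :
    ‖tw f q v‖ ≤ ‖v‖ := by
  by_cases hv : v = 0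
  · simp [hv, tw]
  have hv' : 0 < ‖v‖ := norm_pos_iff.2 hv
  have hq2 : ‖q‖ ^ 2 < 1 := by nlinarith [norm_nonneg q]
  set y : PowerSeries H := mk fun m => star q ^ m * v with hy
  have hyn : ∀ m, ‖coeff m y‖ = ‖q‖ ^ m * ‖v‖ := by
    intro m; simp [hy]
  have hyac : AC y ‖q‖ := by
    apply AC_of_bdd (B := ‖v‖) _ (norm_nonneg _) hq
    intro m
    rw [hyn]
    exact mul_le_of_le_one_left (norm_nonneg _) (pow_le_one₀ (norm_nonneg _) hq.le)
  have hgeo := hasSum_geometric_of_lt_one (by positivity) hq2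
  have hyev : ev y q = (((1 - ‖q‖ ^ 2)⁻¹ : ℝ) : H) * v := by
    unfold ev
    have h1 := ((Quaternion.hasSum_coe (L := .unconditional _)).2 hgeo).mul_right v
    rw [← h1.tsum_eq]
    congr 1; ext1 m
    rw [hy, coeff_mk, ← mul_assoc]
    congr 1
    have hc : Commute q (star q) := by
      show q * star q = star q * q
      rw [Quaternion.self_mul_star, Quaternion.star_mul_self]
    rw [← hc.mul_pow, Quaternion.self_mul_star, Quaternion.normSq_eq_norm_mul_self]
    push_cast
    rw [sq]
  obtain ⟨-, h2⟩ := ev_mul hyac (h.ac hq)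
  rw [hyev] at h2
  have h3 : tw f q ((((1 - ‖q‖ ^ 2)⁻¹ : ℝ) : H) * v)
      = (((1 - ‖q‖ ^ 2)⁻¹ : ℝ) : H) * tw f q v := by
    unfold tw
    rw [← tsum_mul_left]
    congr 1; ext1 m
    simp only [← mul_assoc]
    rw [Quaternion.coe_commutes]
  rw [h3] at h2
  have hb : ∀ N, ∑ m ∈ Finset.range N, ‖coeff m (y * f)‖ ^ 2 ≤ ‖v‖ ^ 2 * (1 - ‖q‖ ^ 2)⁻¹ := by
    intro N
    refine (h N y).trans ?_
    rw [← hgeo.tsum_eq, ← tsum_mul_left]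
    have : ∀ m, ‖coeff m y‖ ^ 2 = ‖v‖ ^ 2 * (‖q‖ ^ 2) ^ m := by
      intro m; rw [hyn]; ring
    simp_rw [this]
    exact (hgeo.summable.mul_left _).sum_le_tsum _ (fun i _ => by positivity)
  have hbs : Summable fun m => ‖coeff m (y * f)‖ ^ 2 :=
    summable_of_sum_range_le (fun m => by positivity) hb
  have hbt : ∑' m, ‖coeff m (y * f)‖ ^ 2 ≤ ‖v‖ ^ 2 * (1 - ‖q‖ ^ 2)⁻¹ :=
    hbs.tsum_le_of_sum_range_le hb
  have hle : ∀ m, ‖q ^ m * coeff m (y * f)‖ ≤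
      (‖v‖ / 2) * (‖q‖ ^ 2) ^ m + (1 / (2 * ‖v‖)) * ‖coeff m (y * f)‖ ^ 2 := by
    intro m
    rw [norm_mul, norm_pow]
    set A := ‖q‖ ^ m
    set B := ‖coeff m (y * f)‖
    have : (‖q‖ ^ 2) ^ m = A ^ 2 := by simp only [A]; ring
    rw [this]
    have h5 : (‖v‖ / 2) * A ^ 2 + (1 / (2 * ‖v‖)) * B ^ 2 - A * B
      = (‖v‖ * A - B) ^ 2 / (2 * ‖v‖) := by field_simp; ring
    have h6 : 0 ≤ (‖v‖ * A - B) ^ 2 / (2 * ‖v‖) := by positivity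
    linarith
  have hS : Summable fun m => (‖v‖ / 2) * (‖q‖ ^ 2) ^ m + (1 / (2 * ‖v‖)) * ‖coeff m (y * f)‖ ^ 2 :=
    (hgeo.summable.mul_left _).add (hbs.mul_left _)
  have h7 := tsum_of_norm_bounded hS.hasSum hle
  change ‖ev (y * f) q‖ ≤ _ at h7
  rw [(hgeo.summable.mul_left _).tsum_add (hbs.mul_left _), tsum_mul_left, tsum_mul_left,
    hgeo.tsum_eq, h2, norm_mul, Quaternion.norm_coe, Real.norm_of_nonneg
      (inv_nonneg.2 (by linarith))] at h7
  have hpos : 0 < (1 - ‖q‖ ^ 2)⁻¹ := inv_pos.2 (by linarith)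
  have h8 : (1 / (2 * ‖v‖)) * ∑' m, ‖coeff m (y * f)‖ ^ 2
      ≤ (1 / (2 * ‖v‖)) * (‖v‖ ^ 2 * (1 - ‖q‖ ^ 2)⁻¹) :=
    mul_le_mul_of_nonneg_left hbt (by positivity)
  have h9 : (1 / (2 * ‖v‖)) * (‖v‖ ^ 2 * (1 - ‖q‖ ^ 2)⁻¹) = ‖v‖ / 2 * (1 - ‖q‖ ^ 2)⁻¹ := by
    field_simp
  have h10 : (1 - ‖q‖ ^ 2)⁻¹ * ‖tw f q v‖ ≤ (1 - ‖q‖ ^ 2)⁻¹ * ‖v‖ := by linarith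
  exact le_of_mul_le_mul_left h10 hpos

end Aux1

section Aux2
open PowerSeries

theorem energy1 (x F w : H) : ‖x - F * star w‖ ^ 2 - ‖F - x * w‖ ^ 2
    = (1 - ‖w‖ ^ 2) * (‖x‖ ^ 2 - ‖F‖ ^ 2) := by
  rw [norm_sub_sq_real, norm_sub_sq_real, real_inner_comm (x * w) F]
  have : inner ℝ x (F * star w) = inner ℝ (x * w) F := by
    rw [Quaternion.inner_def, Quaternion.inner_def, star_mul, star_star, mul_assoc]
  rw [this]
  simp only [norm_mul, norm_star]
  ring

theorem energy2 (r : ℝ) (k k' : H) : ‖k - (r : H) * k'‖ ^ 2 - ‖k' - (r : H) * k‖ ^ 2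
    = (1 - r ^ 2) * (‖k‖ ^ 2 - ‖k'‖ ^ 2) := by
  rw [Quaternion.coe_mul_eq_smul, Quaternion.coe_mul_eq_smul, norm_sub_sq_real, norm_sub_sq_real,
    real_inner_smul_right, real_inner_smul_right, real_inner_comm k k', norm_smul, norm_smul,
    mul_pow, mul_pow, Real.norm_eq_abs, sq_abs]
  ring

theorem Cr_comm (r : ℝ) (f : PowerSeries H) : C (r : H) * f = f * C (r : H) := by
  ext1 n
  rw [coeff_C_mul, coeff_mul_C, Quaternion.coe_commutes]

theorem exists_inv (B : PowerSeries H) (h : coeff 0 B ≠ 0) : ∃ J, B * J = 1 ∧ J * B = 1 := by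
  have h1 := mk_starInvC (fun n => coeff n B) h
  have h2 : (mk fun n => coeff n B) = B := by ext1 n; simp
  rw [h2] at h1
  refine ⟨_, h1, ?_⟩
  set J := mk (starInvC fun n => coeff n B)
  have hJ : J ≠ 0 := by
    rintro h0; rw [h0, mul_zero] at h1; exact zero_ne_one h1
  apply mul_right_cancel₀ hJ
  rw [mul_assoc, h1, mul_one, one_mul]

theorem back_rec {r : ℝ} (hr : |r| < 1) {k b : ℕ → H} {K e : ℝ} (M : ℕ)
    (hk : ∀ m, ‖k m‖ ≤ K * (m + 1)) (hrec : ∀ m, k m = (r : H) * k (m + 1) + b (m + 1))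
    (hb : ∀ m, M ≤ m → ‖b m‖ ≤ e) : ∀ m, M ≤ m → ‖k m‖ ≤ e / (1 - |r|) := by
  intro m hm
  have he : 0 ≤ e := (norm_nonneg _).trans (hb M le_rfl)
  have h1 : 0 < 1 - |r| := by linarith
  have key : ∀ j : ℕ, ‖k m‖ ≤ |r| ^ j * ‖k (m + j)‖ + e / (1 - |r|) * (1 - |r| ^ j) := by
    intro j
    induction j with
    | zero => simp
    | succ j ih =>
      have h2 : ‖k (m + j)‖ ≤ |r| * ‖k (m + (j + 1))‖ + e := by
        rw [hrec (m + j)]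
        refine (norm_add_le _ _).trans ?_
        rw [norm_mul, Quaternion.norm_coe, Real.norm_eq_abs]
        exact add_le_add le_rfl (hb _ (by omega))
      have h3 := mul_le_mul_of_nonneg_left h2 (pow_nonneg (abs_nonneg r) j)
      have h4 : e / (1 - |r|) * (1 - |r| ^ (j + 1))
        = e / (1 - |r|) * (1 - |r| ^ j) + |r| ^ j * e := by
        field_simp; ring
      rw [h4, pow_succ]
      linarith
  have hK : ∀ j : ℕ, ‖k m‖ ≤ (K * (m + 1)) * |r| ^ j + K * (j * |r| ^ j) + e / (1 - |r|) := by
    intro j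
    have h5 := mul_le_mul_of_nonneg_left (hk (m + j)) (pow_nonneg (abs_nonneg r) j)
    have h6 : 0 ≤ e / (1 - |r|) * |r| ^ j := by positivity
    have := key j
    push_cast at h5
    nlinarith
  have ht : Filter.Tendsto (fun j : ℕ => (K * (m + 1)) * |r| ^ j + K * (j * |r| ^ j) + e / (1 - |r|))
      Filter.atTop (nhds ((K * (m + 1)) * 0 + K * 0 + e / (1 - |r|))) := by
    refine ((Filter.Tendsto.const_mul _ ?_).add (Filter.Tendsto.const_mul _ ?_)).add
      tendsto_const_nhds
    · exact tendsto_pow_atTop_nhds_zero_of_lt_one (abs_nonneg r) hr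
    · exact tendsto_self_mul_const_pow_of_lt_one (abs_nonneg r) hr
  have := ge_of_tendsto' ht hK
  simpa using this

theorem schur_hdq {a R h : PowerSeries H} (ha : Schur a) {r : ℝ} (hr : |r| < 1) {w : H}
    (hw : ‖w‖ < 1) {B : ℝ} (hR : ∀ m, ‖coeff m R‖ ≤ B)
    (h1 : (X - C (r : H)) * R = a - C w)
    (h2 : (1 - a * C (star w)) * h = (1 - C (r : H) * X) * R) : Schur h := by
  intro N y
  have hw0 := norm_nonneg w
  set y' : PowerSeries H := ((trunc N y : Polynomial H) : PowerSeries H) with hy'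
  have hyc : ∀ m, coeff m y' = if m < N then coeff m y else 0 := by
    intro m; rw [hy', Polynomial.coeff_coe, coeff_trunc]
  have hk : ∀ m, m < N → coeff m (y * h) = coeff m (y' * h) := by
    intro m hm
    rw [coeff_mul, coeff_mul]
    apply Finset.sum_congr rfl
    intro p hp
    have := Finset.HasAntidiagonal.mem_antidiagonal.1 hp
    rw [hyc, if_pos (by omega)]
  have hB0 : coeff 0 (1 - a * C (star w)) ≠ 0 := by
    rw [map_sub, coeff_mul_C]
    simp only [coeff_zero_one]
    intro h0
    have h3 : ‖coeff 0 a * star w‖ = 1 := by rw [← sub_eq_zero.1 h0, norm_one]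
    rw [norm_mul, norm_star] at h3
    nlinarith [ha.bdd 0, norm_nonneg (coeff 0 a)]
  obtain ⟨J, -, hJ⟩ := exists_inv _ hB0
  set x := y' * J with hx
  have hxy : x - x * a * C (star w) = y' := by
    have : x * (1 - a * C (star w)) = y' := by rw [hx, mul_assoc, hJ, mul_one]
    rw [← this, mul_sub, mul_one, mul_assoc]
  set b := x * a - x * C w with hb
  set κ := x * R with hκ
  have hbκ : (X - C (r : H)) * κ = b := by
    have : (X - C (r : H)) * x = x * (X - C (r : H)) := by
      rw [sub_mul, mul_sub, X_mul, Cr_comm]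
    rw [hκ, ← mul_assoc, this, mul_assoc, h1, mul_sub]
  have hkκ : (1 - C (r : H) * X) * κ = y' * h := by
    have e1 : (1 - C (r : H) * X) * x = x * (1 - C (r : H) * X) := by
      rw [sub_mul, mul_sub, one_mul, mul_one, mul_assoc, X_mul, ← mul_assoc, Cr_comm, mul_assoc]
    have e2 : y' = x * (1 - a * C (star w)) := by rw [hx, mul_assoc, hJ, mul_one]
    rw [hκ, ← mul_assoc, e1, mul_assoc, ← h2, ← mul_assoc, ← e2]
  -- coefficient formulas
  have cy : ∀ m, coeff m y' = coeff m x - coeff m (x * a) * star w := by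
    intro m; rw [← hxy, map_sub, coeff_mul_C]
  have cb : ∀ m, coeff m b = coeff m (x * a) - coeff m x * w := by
    intro m; rw [hb, map_sub, coeff_mul_C]
  -- sums of y'
  set S := ∑ m ∈ Finset.range N, ‖coeff m y‖ ^ 2 with hS
  have hySum : ∀ M, ∑ m ∈ Finset.range M, ‖coeff m y'‖ ^ 2 ≤ S := by
    intro M
    have e1 : ∑ m ∈ Finset.range N, ‖coeff m y'‖ ^ 2 = S := by
      apply Finset.sum_congr rfl
      intro m hm
      rw [hyc, if_pos (Finset.mem_range.1 hm)]
    rw [← e1]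
    rcases le_total M N with hMN | hMN
    · exact Finset.sum_le_sum_of_subset_of_nonneg (Finset.range_mono hMN)
        (fun _ _ _ => by positivity)
    · apply le_of_eq
      symm
      apply Finset.sum_subset (Finset.range_mono hMN)
      intro m _ hm
      rw [hyc, if_neg (by simpa using hm)]
      simp
  have hbSum : ∀ M, ∑ m ∈ Finset.range M, ‖coeff m b‖ ^ 2 ≤ S := by
    intro M
    refine le_trans ?_ (hySum M)
    have e1 : ∑ m ∈ Finset.range M, (‖coeff m y'‖ ^ 2 - ‖coeff m b‖ ^ 2)
        = (1 - ‖w‖ ^ 2) * (∑ m ∈ Finset.range M, ‖coeff m x‖ ^ 2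
          - ∑ m ∈ Finset.range M, ‖coeff m (x * a)‖ ^ 2) := by
      rw [← Finset.sum_sub_distrib, Finset.mul_sum]
      apply Finset.sum_congr rfl
      intro m _
      rw [cy, cb, energy1]
    rw [Finset.sum_sub_distrib] at e1
    have e2 := ha M x
    have e3 : 0 ≤ 1 - ‖w‖ ^ 2 := by nlinarith
    nlinarith [mul_nonneg e3 (sub_nonneg.2 e2)]
  -- x is bounded
  have hc : 0 < 1 - ‖w‖ := by linarith
  have hxSum : ∀ M, ∑ m ∈ Finset.range M, ‖coeff m x‖ ^ 2 ≤ S / (1 - ‖w‖) ^ 2 := by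
    intro M
    have e1 : ∀ m, ‖coeff m x‖ ^ 2 ≤ ‖coeff m y'‖ ^ 2 / (1 - ‖w‖) + ‖w‖ * ‖coeff m (x * a)‖ ^ 2 := by
      intro m
      have t1 : ‖coeff m x‖ ≤ ‖coeff m y'‖ + ‖coeff m (x * a)‖ * ‖w‖ := by
        have : coeff m x = coeff m y' + coeff m (x * a) * star w := by rw [cy]; abel
        rw [this]
        refine (norm_add_le _ _).trans ?_
        rw [norm_mul, norm_star]
      set A := ‖coeff m x‖
      set Y := ‖coeff m y'‖
      set F := ‖coeff m (x * a)‖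
      have t2 : A ^ 2 ≤ (Y + F * ‖w‖) ^ 2 := pow_le_pow_left₀ (norm_nonneg _) t1 2
      have t3 : Y ^ 2 / (1 - ‖w‖) + ‖w‖ * F ^ 2 - (Y + F * ‖w‖) ^ 2
          = ‖w‖ * (Y - (1 - ‖w‖) * F) ^ 2 / (1 - ‖w‖) := by
        field_simp; ring
      have t4 : 0 ≤ ‖w‖ * (Y - (1 - ‖w‖) * F) ^ 2 / (1 - ‖w‖) := by positivity
      linarith
    have e2 := Finset.sum_le_sum (s := Finset.range M) (fun m _ => e1 m)
    rw [Finset.sum_add_distrib, ← Finset.mul_sum, ← Finset.sum_div] at e2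
    have e3 := mul_le_mul_of_nonneg_left (ha M x) hw0
    have e4 : (∑ m ∈ Finset.range M, ‖coeff m y'‖ ^ 2) / (1 - ‖w‖) ≤ S / (1 - ‖w‖) :=
      div_le_div_of_nonneg_right (hySum M) hc.le
    have e5 : S / (1 - ‖w‖) ^ 2 = (S / (1 - ‖w‖)) / (1 - ‖w‖) := by field_simp
    rw [e5, le_div_iff₀ hc]
    linarith
  obtain ⟨D, hD0, hD⟩ : ∃ D : ℝ, 0 ≤ D ∧ ∀ m, ‖coeff m x‖ ≤ D := by
    refine ⟨√(S / (1 - ‖w‖) ^ 2), Real.sqrt_nonneg _, fun m => ?_⟩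
    apply Real.le_sqrt_of_sq_le
    refine le_trans ?_ (hxSum (m + 1))
    exact Finset.single_le_sum (f := fun m => ‖coeff m x‖ ^ 2)
      (fun i _ => by positivity) (Finset.self_mem_range_succ m)
  have hκb : ∀ m : ℕ, ‖coeff m κ‖ ≤ (D * B) * (m + 1) := by
    intro m
    rw [hκ, coeff_mul]
    refine (norm_sum_le _ _).trans ?_
    have : ∀ p ∈ Finset.HasAntidiagonal.antidiagonal m, ‖coeff p.1 x * coeff p.2 R‖ ≤ D * B := by
      intro p _
      rw [norm_mul]
      exact mul_le_mul (hD _) (hR _) (norm_nonneg _) hD0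
    refine (Finset.sum_le_card_nsmul _ _ _ this).trans ?_
    rw [Finset.Nat.card_antidiagonal, nsmul_eq_mul]
    push_cast
    linarith
  have hrec : ∀ m, coeff m κ = (r : H) * coeff (m + 1) κ + coeff (m + 1) b := by
    intro m
    rw [← hbκ, sub_mul, map_sub, coeff_succ_X_mul, coeff_C_mul]; abel
  have hbs : Filter.Tendsto (fun m => ‖coeff m b‖) Filter.atTop (nhds 0) := by
    have e1 : Summable fun m => ‖coeff m b‖ ^ 2 :=
      summable_of_sum_range_le (fun m => by positivity) hbSum
    have e2 := e1.tendsto_atTop_zero.sqrt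
    simpa using e2
  -- energy
  have hen : ∀ M, ∑ m ∈ Finset.range (M + 1), ‖coeff m (y' * h)‖ ^ 2
      = ∑ m ∈ Finset.range (M + 1), ‖coeff m b‖ ^ 2 + (1 - r ^ 2) * ‖coeff M κ‖ ^ 2 := by
    intro M
    induction M with
    | zero =>
      rw [← hkκ, ← hbκ]
      simp only [zero_add, Finset.sum_range_one, sub_mul, map_sub, one_mul, mul_assoc, coeff_C_mul,
        coeff_zero_X_mul, mul_zero, sub_zero, zero_sub, norm_neg, norm_mul, Quaternion.norm_coe,
        Real.norm_eq_abs, mul_pow, sq_abs]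
      ring
    | succ M ih =>
      rw [Finset.sum_range_succ, ih, Finset.sum_range_succ _ (M + 1)]
      have e1 : coeff (M + 1) (y' * h) = coeff (M + 1) κ - (r : H) * coeff M κ := by
        rw [← hkκ, sub_mul, one_mul, map_sub, mul_assoc, coeff_C_mul, coeff_succ_X_mul]
      have e2 : coeff (M + 1) b = coeff M κ - (r : H) * coeff (M + 1) κ := by
        rw [hrec M]; abel
      have := energy2 r (coeff (M + 1) κ) (coeff M κ)
      rw [e1, e2]
      linarith
  have hr2 : 0 ≤ 1 - r ^ 2 := by nlinarith [abs_nonneg r, sq_abs r]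
  have hr1 : 0 < 1 - |r| := by linarith
  have hfin : ∀ e : ℝ, 0 < e → ∑ m ∈ Finset.range N, ‖coeff m (y * h)‖ ^ 2
      ≤ S + (1 - r ^ 2) * (e / (1 - |r|)) ^ 2 := by
    intro e he
    have := (hbs.eventually (gt_mem_nhds he))
    obtain ⟨M, hM⟩ := Filter.eventually_atTop.1 this
    have hM' := back_rec hr M hκb hrec (fun m hm => (hM m hm).le)
    have e1 : ∑ m ∈ Finset.range N, ‖coeff m (y * h)‖ ^ 2
        = ∑ m ∈ Finset.range N, ‖coeff m (y' * h)‖ ^ 2 := by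
      apply Finset.sum_congr rfl
      intro m hm
      rw [hk m (Finset.mem_range.1 hm)]
    have e2 : ∑ m ∈ Finset.range N, ‖coeff m (y' * h)‖ ^ 2
        ≤ ∑ m ∈ Finset.range (max M N + 1), ‖coeff m (y' * h)‖ ^ 2 :=
      Finset.sum_le_sum_of_subset_of_nonneg (Finset.range_mono (by omega))
        (fun _ _ _ => by positivity)
    have e3 := pow_le_pow_left₀ (norm_nonneg _) (hM' (max M N) (le_max_left _ _)) 2
    rw [e1]
    refine e2.trans ?_
    rw [hen]
    exact add_le_add (hbSum _) (mul_le_mul_of_nonneg_left e3 hr2)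
  have ht : Filter.Tendsto (fun e : ℝ => S + (1 - r ^ 2) * (e / (1 - |r|)) ^ 2)
      (nhdsWithin 0 (Set.Ioi 0)) (nhds (S + (1 - r ^ 2) * (0 / (1 - |r|)) ^ 2)) := by
    apply Filter.Tendsto.mono_left _ nhdsWithin_le_nhds
    apply Continuous.tendsto (f := fun e : ℝ => S + (1 - r ^ 2) * (e / (1 - |r|)) ^ 2)
    fun_prop
  have := ge_of_tendsto ht (Filter.eventually_of_mem self_mem_nhdsWithin hfin)
  simpa using this

end Aux2

section Aux3
open PowerSeries

/-- Real part as an additive map. -/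
def reHom : H →+ ℝ where
  toFun u := u.re
  map_zero' := Quaternion.re_zero
  map_add' _ _ := Quaternion.re_add _ _

theorem parseval (K : ℕ) (hK : K ≠ 0) : ∃ Z : H, ‖Z‖ = 1 ∧ ∀ c : ℕ → H,
    ∑ k ∈ Finset.range K, ‖∑ m ∈ Finset.range K, (Z ^ k) ^ m * c m‖ ^ 2
      = K * ∑ m ∈ Finset.range K, ‖c m‖ ^ 2 := by
  have hz := Complex.isPrimitiveRoot_exp K hK
  set z := Complex.exp (2 * Real.pi * Complex.I / K) with hzdef
  have hinj : Function.Injective Quaternion.ofComplex := Quaternion.ofComplex.toRingHom.injective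
  set Z : H := Quaternion.ofComplex z with hZ
  have hZK : Z ^ K = 1 := by rw [hZ, ← map_pow, hz.pow_eq_one, map_one]
  have hZi : ∀ m l : ℕ, m < K → l < K → Z ^ m = Z ^ l → m = l := by
    intro m l hm hl h
    rw [hZ, ← map_pow, ← map_pow] at h
    exact hz.pow_inj hm hl (hinj h)
  have hZ1 : ‖Z‖ = 1 := 
    (pow_eq_one_iff_of_nonneg (norm_nonneg _) hK).1 (by rw [← norm_pow, hZK, norm_one])
  have hZ0 : Z ≠ 0 := by rw [← norm_pos_iff, hZ1]; exact one_pos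
  have hst : star Z = Z⁻¹ := by
    apply eq_inv_of_mul_eq_one_left
    rw [Quaternion.star_mul_self, Quaternion.normSq_eq_norm_mul_self, hZ1]; simp
  refine ⟨Z, hZ1, fun c => ?_⟩
  have hin : ∀ k m l : ℕ, inner ℝ ((Z ^ k) ^ m * c m) ((Z ^ k) ^ l * c l)
      = (c m * star (c l) * ((Z⁻¹ ^ l) * Z ^ m) ^ k).re := by
    intro k m l
    have hc : Commute (Z⁻¹ ^ l) (Z ^ m) := ((Commute.refl Z).inv_left₀).pow_pow _ _
    rw [Quaternion.inner_def, star_mul, star_pow, star_pow, hst, hc.mul_pow, ← pow_mul, ← pow_mul,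
      ← pow_mul, ← pow_mul, mul_comm k m, mul_comm k l]
    have hre : ∀ u v : H, (u * v).re = (v * u).re := by
      intro u v; simp only [Quaternion.re_mul]; ring
    rw [mul_assoc, hre]
    simp only [mul_assoc]
  have hgeo : ∀ m l : ℕ, m < K → l < K → m ≠ l →
      ∑ k ∈ Finset.range K, ((Z⁻¹ ^ l) * Z ^ m) ^ k = 0 := by
    intro m l hm hl hne
    have hc : Commute (Z⁻¹ ^ l) (Z ^ m) := ((Commute.refl Z).inv_left₀).pow_pow _ _
    set w := (Z⁻¹ ^ l) * Z ^ m with hw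
    have hw1 : w - 1 ≠ 0 := by
      intro h0
      apply hne
      apply hZi m l hm hl
      have h1 : w = 1 := sub_eq_zero.1 h0
      rw [hw, inv_pow] at h1
      exact (inv_mul_eq_one₀ (pow_ne_zero _ hZ0)).1 h1 |>.symm
    have hwK : w ^ K = 1 := by
      rw [hw, hc.mul_pow, ← pow_mul, ← pow_mul, mul_comm l, mul_comm m, pow_mul, pow_mul, hZK,
        inv_pow, hZK]; simp
    have := geom_sum_mul w K
    rw [hwK, sub_self] at this
    exact (mul_eq_zero.1 this).resolve_right hw1
  simp_rw [← real_inner_self_eq_norm_sq, sum_inner, inner_sum, hin]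
  rw [Finset.sum_comm, Finset.mul_sum]
  apply Finset.sum_congr rfl
  intro m hm
  rw [Finset.mem_range] at hm
  rw [Finset.sum_comm, Finset.sum_eq_single m]
  · have : Z⁻¹ ^ m * Z ^ m = 1 := by
      rw [inv_pow]; exact inv_mul_cancel₀ (pow_ne_zero _ hZ0)
    simp only [this, one_pow, mul_one, Finset.sum_const, Finset.card_range, nsmul_eq_mul]
    rw [Quaternion.inner_def]
  · intro l hl hlm
    rw [Finset.mem_range] at hl
    have h1 : ∑ k ∈ Finset.range K, (c m * star (c l) * ((Z⁻¹ ^ l) * Z ^ m) ^ k) = 0 := by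
      rw [← Finset.mul_sum, hgeo m l hm hl hlm.symm, mul_zero]
    have h2 := congrArg (fun u : H => u.re) h1
    simp only [Quaternion.re_zero] at h2
    refine Eq.trans ?_ h2
    exact (map_sum reHom (fun k => c m * star (c l) * ((Z⁻¹ ^ l) * Z ^ m) ^ k) (Finset.range K)).symm
  · intro h; exact absurd (Finset.mem_range.2 hm) h

theorem AC_fin {P : PowerSeries H} {K : ℕ} (hP : ∀ m, K ≤ m → coeff m P = 0) (t : ℝ) : AC P t := by
  apply summable_of_ne_finset_zero (s := Finset.range K)
  intro m hm
  rw [hP m (by simpa using hm)]; simp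

theorem parseval_ev {P : PowerSeries H} {K : ℕ} (hP : ∀ m, K ≤ m → coeff m P = 0) (t : ℝ) {Z : H}
    (hZ : ∀ c : ℕ → H, ∑ k ∈ Finset.range K, ‖∑ m ∈ Finset.range K, (Z ^ k) ^ m * c m‖ ^ 2
      = K * ∑ m ∈ Finset.range K, ‖c m‖ ^ 2) :
    ∑ k ∈ Finset.range K, ‖ev P ((t : H) * Z ^ k)‖ ^ 2
      = K * ∑ m ∈ Finset.range K, (t ^ m) ^ 2 * ‖coeff m P‖ ^ 2 := by
  have h1 := hZ (fun m => (t : H) ^ m * coeff m P)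
  have h2 : ∀ m, ‖(t : H) ^ m * coeff m P‖ ^ 2 = (t ^ m) ^ 2 * ‖coeff m P‖ ^ 2 := by
    intro m
    rw [norm_mul, norm_pow, Quaternion.norm_coe, Real.norm_eq_abs, mul_pow, ← abs_pow, sq_abs]
  simp_rw [h2] at h1
  rw [← h1]
  apply Finset.sum_congr rfl
  intro k _
  congr 2
  unfold ev
  rw [tsum_eq_sum (s := Finset.range K)]
  · apply Finset.sum_congr rfl
    intro m _
    have hc : Commute (t : H) (Z ^ k) := Quaternion.coe_commutes t _
    rw [hc.mul_pow, (hc.pow_pow m m).eq, mul_assoc]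
  · intro m hm
    rw [hP m (by simpa using hm), mul_zero]

theorem selfMap_ac {a : ℕ → H} (ha : SelfMap a) {t : ℝ} (h0 : 0 ≤ t) (h1 : t < 1) :
    AC (mk a) t := by
  have h2 := ha.1 (t : H) (by rw [Quaternion.norm_coe, Real.norm_of_nonneg h0]; exact h1)
  have h3 := h2.norm
  refine h3.congr ?_
  intro m
  rw [norm_mul, norm_pow, Quaternion.norm_coe, Real.norm_of_nonneg h0, coeff_mk]

theorem selfMap_schur_aux {a : ℕ → H} (ha : SelfMap a) {t : ℝ} (h0 : 0 < t) (h1 : t < 1)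
    (N : ℕ) (x : PowerSeries H) :
    ∑ m ∈ Finset.range N, (t ^ m) ^ 2 * ‖coeff m (x * mk a)‖ ^ 2
    ≤ ∑ m ∈ Finset.range N, (t ^ m) ^ 2 * ‖coeff m x‖ ^ 2 := by
  have hac := selfMap_ac ha h0.le h1
  set e : ℕ → ℝ := fun n => ∑' j, t ^ (j + n) * ‖a (j + n)‖ with he
  have he0 : ∀ n, 0 ≤ e n := fun n => tsum_nonneg fun j => by positivity
  have hac' : Summable fun m => t ^ m * ‖a m‖ := by
    refine hac.congr ?_
    intro m; rw [coeff_mk]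
  have het : Filter.Tendsto e Filter.atTop (nhds 0) :=
    tendsto_sum_nat_add fun m => t ^ m * ‖a m‖
  -- partial sums
  have hps : ∀ (n : ℕ) (q : H), ‖q‖ = t → ‖∑ j ∈ Finset.range n, q ^ j * a j‖ ≤ 1 + e n := by
    intro n q hq
    have hs : Summable fun j => q ^ j * a j := ha.1 q (by rw [hq]; exact h1)
    have e1 := hs.sum_add_tsum_nat_add n
    have e2 := ha.2 q (by rw [hq]; exact h1)
    have e3 : ‖∑' j, q ^ (j + n) * a (j + n)‖ ≤ e n := by
      apply tsum_of_norm_bounded (((summable_nat_add_iff n).2 hac').hasSum)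
      intro j
      rw [norm_mul, norm_pow, hq]
    have e4 : ∑ j ∈ Finset.range n, q ^ j * a j = evalC a q - ∑' j, q ^ (j + n) * a (j + n) := by
      rw [evalC, ← e1]; abel
    rw [e4]
    refine (norm_sub_le _ _).trans ?_
    linarith
  have hpt : ∀ (n : ℕ) (q v : H), ‖q‖ = t →
      ‖∑ j ∈ Finset.range n, q ^ j * v * a j‖ ≤ ‖v‖ * (1 + e n) := by
    intro n q v hq
    by_cases hv : v = 0
    · simp [hv]
    have e1 : ∑ j ∈ Finset.range n, q ^ j * v * a j
        = v * ∑ j ∈ Finset.range n, (v⁻¹ * q * v) ^ j * a j := by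
      rw [Finset.mul_sum]
      apply Finset.sum_congr rfl
      intro j hj
      clear hj
      have : (v⁻¹ * q * v) ^ j = v⁻¹ * q ^ j * v := by
        induction j with
        | zero => simp [hv]
        | succ j ih =>
          rw [pow_succ, ih, pow_succ]
          simp only [mul_assoc]
          rw [mul_inv_cancel_left₀ hv]
      rw [this]
      simp only [mul_assoc]
      rw [mul_inv_cancel_left₀ hv]
    rw [e1, norm_mul]
    apply mul_le_mul_of_nonneg_left _ (norm_nonneg _)
    apply hps
    rw [norm_mul, norm_mul, norm_inv, hq]
    have : ‖v‖ ≠ 0 := norm_ne_zero_iff.2 hv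
    field_simp
  have main : ∀ n, N < n → ∑ m ∈ Finset.range N, (t ^ m) ^ 2 * ‖coeff m (x * mk a)‖ ^ 2
      ≤ (1 + e n) ^ 2 * ∑ m ∈ Finset.range N, (t ^ m) ^ 2 * ‖coeff m x‖ ^ 2 := by
    intro n hn
    set x' : PowerSeries H := mk fun m => if m < N then coeff m x else 0 with hx'
    set A : PowerSeries H := mk fun m => if m < n then a m else 0 with hA
    set K := N + n with hK
    have hx'0 : ∀ m, N ≤ m → coeff m x' = 0 := by
      intro m hm; rw [hx', coeff_mk, if_neg (by omega)]
    have hA0 : ∀ m, n ≤ m → coeff m A = 0 := by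
      intro m hm; rw [hA, coeff_mk, if_neg (by omega)]
    have hP0 : ∀ m, K ≤ m → coeff m (x' * A) = 0 := by
      intro m hm
      rw [coeff_mul]
      apply Finset.sum_eq_zero
      intro p hp
      have := Finset.HasAntidiagonal.mem_antidiagonal.1 hp
      rcases le_or_gt N p.1 with h | h
      · rw [hx'0 _ h, zero_mul]
      · rw [hA0 p.2 (by omega), mul_zero]
    have hPc : ∀ m, m < N → coeff m (x' * A) = coeff m (x * mk a) := by
      intro m hm
      rw [coeff_mul, coeff_mul]
      apply Finset.sum_congr rfl
      intro p hp
      have := Finset.HasAntidiagonal.mem_antidiagonal.1 hp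
      rw [hx', hA, coeff_mk, coeff_mk, coeff_mk, if_pos (by omega), if_pos (by omega)]
    obtain ⟨Z, hZ1, hZ⟩ := parseval K (by omega)
    have p1 := parseval_ev hP0 t hZ
    have p2 := parseval_ev (P := x') (K := K) (fun m hm => hx'0 m (by omega)) t hZ
    have hcomp : ∀ k, ‖ev (x' * A) ((t : H) * Z ^ k)‖ ^ 2
        ≤ (1 + e n) ^ 2 * ‖ev x' ((t : H) * Z ^ k)‖ ^ 2 := by
      intro k
      set q := (t : H) * Z ^ k with hq
      have hqn : ‖q‖ = t := by
        rw [hq, norm_mul, norm_pow, hZ1, Quaternion.norm_coe, Real.norm_of_nonneg h0.le]; simp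
      rw [(ev_mul (AC_fin hx'0 ‖q‖) (AC_fin hA0 ‖q‖)).2]
      have e1 : tw A q (ev x' q) = ∑ j ∈ Finset.range n, q ^ j * ev x' q * a j := by
        unfold tw
        rw [tsum_eq_sum (s := Finset.range n)]
        · apply Finset.sum_congr rfl
          intro j hj
          rw [hA, coeff_mk, if_pos (Finset.mem_range.1 hj)]
        · intro j hj
          rw [hA0 j (by simpa using hj), mul_zero]
      rw [e1, ← mul_pow, mul_comm]
      exact pow_le_pow_left₀ (norm_nonneg _) (hpt n q _ hqn) 2
    have p3 := Finset.sum_le_sum (s := Finset.range K) fun k _ => hcomp k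
    rw [← Finset.mul_sum, p1, p2] at p3
    have hKpos : (0 : ℝ) < K := by
      have : 0 < K := by omega
      exact_mod_cast this
    have p4 : ∑ m ∈ Finset.range K, (t ^ m) ^ 2 * ‖coeff m (x' * A)‖ ^ 2
        ≤ (1 + e n) ^ 2 * ∑ m ∈ Finset.range K, (t ^ m) ^ 2 * ‖coeff m x'‖ ^ 2 := by
      apply le_of_mul_le_mul_left _ hKpos
      linarith
    have p5 : ∑ m ∈ Finset.range K, (t ^ m) ^ 2 * ‖coeff m x'‖ ^ 2
        = ∑ m ∈ Finset.range N, (t ^ m) ^ 2 * ‖coeff m x‖ ^ 2 := by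
      rw [← Finset.sum_subset (Finset.range_mono (show N ≤ K by omega))]
      · apply Finset.sum_congr rfl
        intro m hm
        rw [hx', coeff_mk, if_pos (Finset.mem_range.1 hm)]
      · intro m _ hm
        rw [hx'0 m (by simpa using hm)]; simp
    rw [p5] at p4
    refine le_trans ?_ p4
    have p6 : ∑ m ∈ Finset.range N, (t ^ m) ^ 2 * ‖coeff m (x * mk a)‖ ^ 2
        = ∑ m ∈ Finset.range N, (t ^ m) ^ 2 * ‖coeff m (x' * A)‖ ^ 2 := by
      apply Finset.sum_congr rfl
      intro m hm
      rw [hPc m (Finset.mem_range.1 hm)]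
    rw [p6]
    exact Finset.sum_le_sum_of_subset_of_nonneg (Finset.range_mono (by omega))
      (fun _ _ _ => by positivity)
  have ht : Filter.Tendsto
      (fun n => (1 + e n) ^ 2 * ∑ m ∈ Finset.range N, (t ^ m) ^ 2 * ‖coeff m x‖ ^ 2)
      Filter.atTop (nhds ((1 + 0) ^ 2 * ∑ m ∈ Finset.range N, (t ^ m) ^ 2 * ‖coeff m x‖ ^ 2)) :=
    ((het.const_add 1).pow 2).mul_const _
  have := ge_of_tendsto ht (Filter.eventually_atTop.2 ⟨N + 1, fun n hn => main n hn⟩)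
  simpa using this

theorem selfMap_schur {a : ℕ → H} (ha : SelfMap a) : Schur (mk a) := by
  intro N x
  have hc : ∀ c : ℕ → ℝ, Filter.Tendsto (fun t : ℝ => ∑ m ∈ Finset.range N, (t ^ m) ^ 2 * c m)
      (nhdsWithin 1 (Set.Iio 1)) (nhds (∑ m ∈ Finset.range N, ((1 : ℝ) ^ m) ^ 2 * c m)) := by
    intro c
    apply Filter.Tendsto.mono_left _ nhdsWithin_le_nhds
    apply Continuous.tendsto (f := fun t : ℝ => ∑ m ∈ Finset.range N, (t ^ m) ^ 2 * c m)
    fun_prop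
  have h1 := hc fun m => ‖coeff m (x * mk a)‖ ^ 2
  have h2 := hc fun m => ‖coeff m x‖ ^ 2
  simp only [one_pow, one_mul] at h1 h2
  refine le_of_tendsto_of_tendsto h1 h2 ?_
  have : Set.Ioo (0 : ℝ) 1 ∈ nhdsWithin (1 : ℝ) (Set.Iio 1) := Ioo_mem_nhdsLT (by norm_num)
  filter_upwards [this] with t ht
  exact selfMap_schur_aux ha ht.1 ht.2 N x

end Aux3

section Aux4
open PowerSeries

theorem AC.sub {f g : PowerSeries H} {t : ℝ} (ht : 0 ≤ t) (hf : AC f t) (hg : AC g t) :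
    AC (f - g) t := by
  refine Summable.of_nonneg_of_le (fun m => by positivity) (fun m => ?_) (hf.add hg)
  rw [← mul_add, map_sub]
  exact mul_le_mul_of_nonneg_left (norm_sub_le _ _) (by positivity)

theorem AC.mul {f g : PowerSeries H} {q : H} (hf : AC f ‖q‖) (hg : AC g ‖q‖) :
    AC (f * g) ‖q‖ := by
  refine ((ev_mul hf hg).1.norm).congr ?_
  intro m; rw [norm_mul, norm_pow]

theorem AC_C (c : H) (t : ℝ) : AC (C c) t := by
  apply AC_fin (K := 1)
  intro m hm
  rw [coeff_C, if_neg (by omega)]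

theorem AC_X (t : ℝ) : AC X t := by
  apply AC_fin (K := 2)
  intro m hm
  rw [coeff_X, if_neg (by omega)]

theorem ev_sub {f g : PowerSeries H} {q : H} (hf : AC f ‖q‖) (hg : AC g ‖q‖) :
    ev (f - g) q = ev f q - ev g q := by
  have h1 := hf.summable_tw 1
  have h2 := hg.summable_tw 1
  simp only [mul_one] at h1 h2
  unfold ev
  rw [← h1.tsum_sub h2]
  simp only [map_sub, mul_sub]

theorem ev_C (c q : H) : ev (C c) q = c := by
  unfold ev
  rw [tsum_eq_single 0]
  · simp
  · intro m hm; rw [coeff_C, if_neg hm, mul_zero]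

theorem ev_X (q : H) : ev X q = q := by
  unfold ev
  rw [tsum_eq_single 1]
  · simp
  · intro m hm; rw [coeff_X, if_neg hm, mul_zero]

theorem ev_mul_C (f : PowerSeries H) (c q : H) : ev (f * C c) q = ev f q * c := by
  unfold ev
  rw [← tsum_mul_right]
  simp only [coeff_mul_C, mul_assoc]

theorem mk_oneMinus (r : ℝ) : mk (oneMinusQPbarC (r : H)) = 1 - C (r : H) * X := by
  ext1 n
  rw [coeff_mk, oneMinusQPbarC, map_sub, coeff_C_mul, coeff_X, coeff_one]
  rcases n with _ | _ | n <;> simp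

theorem mk_denom (a : ℕ → H) (w : H) :
    mk (fun m => (if m = 0 then (1 : H) else 0) - star w * a m) = 1 - C (star w) * mk a := by
  ext1 n
  rw [coeff_mk, map_sub, coeff_C_mul, coeff_one, coeff_mk]

theorem diffQuot_props {a : ℕ → H} (ha : Schur (mk a)) {r : ℝ} (hr : |r| < 1) :
    (∀ m, ‖coeff m (mk (diffQuotC a (r : H)))‖ ≤ (1 - |r|)⁻¹) ∧
    (X - C (r : H)) * mk (diffQuotC a (r : H)) = mk a - C (evalC a (r : H)) := by
  have hab : ∀ m, ‖a m‖ ≤ 1 := by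
    intro m; have := ha.bdd m; rwa [coeff_mk] at this
  have hgeo := hasSum_geometric_of_lt_one (abs_nonneg r) hr
  have hb : ∀ m k, ‖(r : H) ^ k * a (k + m)‖ ≤ |r| ^ k := by
    intro m k
    rw [norm_mul, norm_pow, Quaternion.norm_coe, Real.norm_eq_abs]
    exact mul_le_of_le_one_right (by positivity) (hab _)
  have hs : ∀ m, Summable fun k => (r : H) ^ k * a (k + m) :=
    fun m => Summable.of_norm_bounded hgeo.summable (hb m)
  have hstep : ∀ m, ∑' k, (r : H) ^ k * a (k + m)
      = a m + (r : H) * ∑' k, (r : H) ^ k * a (k + (m + 1)) := by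
    intro m
    rw [(hs m).tsum_eq_zero_add, ← tsum_mul_left]
    simp only [pow_zero, one_mul, zero_add, pow_succ', mul_assoc]
    congr 3
    ext1 k
    rw [show k + 1 + m = k + (m + 1) by ring]
  constructor
  · intro m
    rw [coeff_mk, diffQuotC]
    exact tsum_of_norm_bounded hgeo (hb (m + 1))
  · ext1 n
    rw [sub_mul, map_sub, map_sub, coeff_C_mul, coeff_mk, coeff_mk, coeff_C]
    cases n with
    | zero =>
      have := hstep 0
      rw [coeff_zero_X_mul, if_pos rfl, evalC, diffQuotC]
      simp only [add_zero] at this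
      rw [this]
      simp [add_assoc]
    | succ n =>
      rw [coeff_succ_X_mul, if_neg (by omega), coeff_mk, diffQuotC, diffQuotC]
      have := hstep (n + 1)
      simp only [add_assoc] at this ⊢
      rw [this]
      simp

theorem hdq_props {a : ℕ → H} (ha : Schur (mk a)) {r : ℝ} (hr : |r| < 1)
    (hw : ‖evalC a (r : H)‖ < 1) :
    Schur (mk (hdqC a (r : H))) ∧
    ∀ q : H, ‖q‖ < 1 → (q - (r : H)) * tw (mk (hdqC a (r : H))) q
      (1 - evalC a q * star (evalC a (r : H)))
      = (1 - (r : H) * q) * (evalC a q - evalC a (r : H)) := by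
  set w := evalC a (r : H) with hwdef
  obtain ⟨hR, h1⟩ := diffQuot_props ha hr
  rw [← hwdef] at h1
  set R := mk (diffQuotC a (r : H)) with hRdef
  set f := mk a with hf
  set D := mk (starInvC (fun m => (if m = 0 then (1 : H) else 0) - star w * a m)) with hD
  have hg : mk (hdqC a (r : H)) = (1 - C (r : H) * X) * R * D := by
    rw [hdqC, mk_starMulC, mk_starMulC, mk_oneMinus]
  have hDi : (1 - C (star w) * f) * D = 1 := by
    rw [← mk_denom, hD]
    apply mk_starInvC
    simp only [if_true]
    intro h0
    have h3 : ‖star w * a 0‖ = 1 := by rw [← sub_eq_zero.1 h0, norm_one]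
    have h4 := ha.bdd 0
    rw [hf, coeff_mk] at h4
    rw [norm_mul, norm_star] at h3
    nlinarith [norm_nonneg (a 0), norm_nonneg w]
  have hXr : (X - C (r : H)) ≠ 0 := by
    intro h0
    have := congrArg (coeff 1) h0
    simp [coeff_C] at this
  have hXc : ∀ y : PowerSeries H, (X - C (r : H)) * y = y * (X - C (r : H)) := by
    intro y; rw [sub_mul, mul_sub, X_mul, Cr_comm]
  have hYc : ∀ y : PowerSeries H, (1 - C (r : H) * X) * y = y * (1 - C (r : H) * X) := by
    intro y
    rw [sub_mul, mul_sub, one_mul, mul_one, mul_assoc, X_mul, ← mul_assoc, Cr_comm, mul_assoc]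
  have hww : C w * C (star w) = C (star w) * C w := by
    rw [← map_mul, ← map_mul, Quaternion.self_mul_star, Quaternion.star_mul_self]
  have hww2 : f * (C (star w) * C w) = C w * C (star w) * f := by
    rw [← map_mul, ← map_mul, Quaternion.self_mul_star, Quaternion.star_mul_self, Cr_comm]
  have hcomm : (1 - f * C (star w)) * R = R * (1 - C (star w) * f) := by
    apply mul_left_cancel₀ hXr
    rw [← mul_assoc, hXc, mul_assoc, h1, ← mul_assoc, h1]
    have e1 : (1 - f * C (star w)) * (f - C w)
      = f - C w - f * C (star w) * f + f * (C (star w) * C w) := by noncomm_ring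
    have e2 : (f - C w) * (1 - C (star w) * f)
      = f - C w - f * C (star w) * f + C w * C (star w) * f := by noncomm_ring
    rw [e1, e2, hww2]
  have h2 : (1 - f * C (star w)) * mk (hdqC a (r : H)) = (1 - C (r : H) * X) * R := by
    rw [hg, ← mul_assoc, ← mul_assoc, ← hYc, mul_assoc (1 - C (r : H) * X), hcomm, mul_assoc,
      mul_assoc R, hDi, mul_one]
  have hS := schur_hdq ha hr hw hR h1 h2
  refine ⟨hS, fun q hq => ?_⟩
  set g := mk (hdqC a (r : H)) with hgdef
  have h3 : (X - C (r : H)) * ((1 - f * C (star w)) * g) = (1 - C (r : H) * X) * (f - C w) := by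
    rw [h2, ← mul_assoc, ← hYc, mul_assoc, h1]
  have acf : AC f ‖q‖ := ha.ac hq
  have acg : AC g ‖q‖ := hS.ac hq
  have ac1 : AC (1 : PowerSeries H) ‖q‖ := by
    have := AC_C 1 ‖q‖; rwa [map_one] at this
  have ev1 : ev (1 : PowerSeries H) q = 1 := by
    have := ev_C 1 q; rwa [map_one] at this
  have n0 := norm_nonneg q
  have acfw : AC (f * C (star w)) ‖q‖ := acf.mul (AC_C _ _)
  have acrX : AC (C (r : H) * X) ‖q‖ := (AC_C _ _).mul (AC_X _)
  have h4 := congrArg (fun y => ev y q) h3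
  beta_reduce at h4
  rw [(ev_mul ((AC_X _).sub n0 (AC_C _ _)) ((ac1.sub n0 acfw).mul acg)).2,
    (ev_mul (ac1.sub n0 acrX) (acf.sub n0 (AC_C _ _))).2,
    ev_sub (AC_X _) (AC_C _ _), ev_sub ac1 acrX, ev_X, ev_C, ev1, Cr_comm, ev_mul_C, ev_X,
    tw_comm, tw_comm, (ev_mul (ac1.sub n0 acfw) acg).2, ev_sub ac1 acfw, ev1, ev_mul_C,
    ev_sub acf (AC_C _ _), ev_C] at h4
  · rw [evalC_eq, Quaternion.coe_commutes]
    exact h4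
  · exact (Commute.one_right q).sub_right ((Commute.refl q).mul_right (Quaternion.coe_commutes r q).symm)
  · exact (Commute.refl q).sub_right (Quaternion.coe_commutes r q).symm

theorem schur_smul {a : ℕ → H} (ha : Schur (mk a)) {t : ℝ} (h0 : 0 ≤ t) (h1 : t ≤ 1) :
    Schur (mk fun m => a m * (t : H)) := by
  have e : (mk fun m => a m * (t : H)) = mk a * C (t : H) := by
    ext1 n; rw [coeff_mk, coeff_mul_C, coeff_mk]
  intro N x
  refine le_trans ?_ (ha N x)
  apply Finset.sum_le_sum
  intro m _
  rw [e, ← mul_assoc, coeff_mul_C, norm_mul, Quaternion.norm_coe, Real.norm_of_nonneg h0]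
  apply pow_le_pow_left₀ (by positivity)
  exact mul_le_of_le_one_right (norm_nonneg _) h1

theorem schur_eval_le {a : ℕ → H} (ha : Schur (mk a)) {q : H} (hq : ‖q‖ < 1) :
    ‖evalC a q‖ ≤ 1 := by
  rw [evalC_eq, ev_eq_tw]
  simpa using ha.tw_le hq 1

theorem schwarz_pick {a : ℕ → H} (ha : Schur (mk a)) {r : ℝ} (hr : |r| < 1) {q : H}
    (hq : ‖q‖ < 1) :
    ‖1 - (r : H) * q‖ * ‖evalC a q - evalC a (r : H)‖
      ≤ ‖q - (r : H)‖ * ‖1 - evalC a q * star (evalC a (r : H))‖ := by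
  have hrn : ‖(r : H)‖ < 1 := by rwa [Quaternion.norm_coe]
  have key : ∀ t ∈ Set.Ioo (0 : ℝ) 1, 
      ‖1 - (r : H) * q‖ * ‖evalC a q * (t : H) - evalC a (r : H) * (t : H)‖
      ≤ ‖q - (r : H)‖ * ‖1 - evalC a q * (t : H) * star (evalC a (r : H) * (t : H))‖ := by
    intro t ht
    have e : ∀ p, evalC (fun m => a m * (t : H)) p = evalC a p * (t : H) := by
      intro p
      unfold evalC
      rw [← tsum_mul_right]
      simp only [mul_assoc]
    have hS := schur_smul ha ht.1.le ht.2.le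
    have hw : ‖evalC (fun m => a m * (t : H)) (r : H)‖ < 1 := by
      rw [e, norm_mul, Quaternion.norm_coe, Real.norm_of_nonneg ht.1.le]
      have := schur_eval_le ha hrn
      nlinarith [ht.1, ht.2, norm_nonneg (evalC a (r : H))]
    obtain ⟨hg, hid⟩ := hdq_props hS hr hw
    have h1 := congrArg norm (hid q hq)
    rw [norm_mul, norm_mul] at h1
    simp only [e] at h1
    rw [← h1]
    exact mul_le_mul_of_nonneg_left (hg.tw_le hq _) (norm_nonneg _)
  have hc : Continuous fun t : ℝ => (t : H) := Quaternion.continuous_coe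
  have l1 : Filter.Tendsto (fun t : ℝ =>
      ‖1 - (r : H) * q‖ * ‖evalC a q * (t : H) - evalC a (r : H) * (t : H)‖)
      (nhdsWithin 1 (Set.Iio 1)) (nhds (‖1 - (r : H) * q‖ *
        ‖evalC a q * ((1 : ℝ) : H) - evalC a (r : H) * ((1 : ℝ) : H)‖)) := by
    apply Filter.Tendsto.mono_left _ nhdsWithin_le_nhds
    apply Continuous.tendsto (f := fun t : ℝ =>
      ‖1 - (r : H) * q‖ * ‖evalC a q * (t : H) - evalC a (r : H) * (t : H)‖)
    fun_prop
  have l2 : Filter.Tendsto (fun t : ℝ =>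
      ‖q - (r : H)‖ * ‖1 - evalC a q * (t : H) * star (evalC a (r : H) * (t : H))‖)
      (nhdsWithin 1 (Set.Iio 1)) (nhds (‖q - (r : H)‖ *
        ‖1 - evalC a q * ((1 : ℝ) : H) * star (evalC a (r : H) * ((1 : ℝ) : H))‖)) := by
    apply Filter.Tendsto.mono_left _ nhdsWithin_le_nhds
    apply Continuous.tendsto (f := fun t : ℝ =>
      ‖q - (r : H)‖ * ‖1 - evalC a q * (t : H) * star (evalC a (r : H) * (t : H))‖)
    fun_prop
  have := le_of_tendsto_of_tendsto l1 l2 (Filter.eventually_of_mem (Ioo_mem_nhdsLT (by norm_num)) key)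
  simpa using this

/-- artanh -/
def art (u : ℝ) : ℝ := (1/2 : ℝ) * Real.log ((1 + u) / (1 - u))

theorem art_nonneg {u : ℝ} (h0 : 0 ≤ u) (h1 : u ≤ 1) : 0 ≤ art u := by
  unfold art
  rcases h1.eq_or_lt with h | h
  · simp [h]
  · have : 0 ≤ Real.log ((1 + u) / (1 - u)) := by
      apply Real.log_nonneg
      rw [le_div_iff₀ (by linarith)]
      linarith
    linarith

theorem art_le {u w p : ℝ} (hu : 0 ≤ u) (hu1 : u < 1) (hw : 0 ≤ w) (hw1 : w < 1) (hp : 0 ≤ p)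
    (hp1 : p < 1) (h : u - w ≤ p * (1 - u * w)) : art u ≤ art w + art p := by
  unfold art
  have a1 : 0 < 1 - u := by linarith
  have a2 : 0 < 1 - w := by linarith
  have a3 : 0 < 1 - p := by linarith
  rw [← mul_add, ← Real.log_mul (by positivity) (by positivity)]
  apply mul_le_mul_of_nonneg_left _ (by norm_num)
  apply Real.log_le_log (by positivity)
  rw [div_mul_div_comm, div_le_div_iff₀ a1 (by positivity)]
  nlinarith

theorem pdist_zero (v : H) : pdist 0 v = art ‖v‖ := by
  simp [pdist, rho, mobiusM, art]

/-- Symmetric form of the pseudo-hyperbolic distance to a real point. -/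
theorem rho_props (p : H) (hp : ‖p‖ < 1) {r : ℝ} (hr : |r| < 1) :
    0 ≤ rho p (r : H) ∧ rho p (r : H) < 1 ∧
      ‖p - (r : H)‖ = rho p (r : H) * ‖1 - (r : H) * p‖ := by
  have h1 : ‖1 - (r : H) * star p‖ = ‖1 - (r : H) * p‖ := by
    rw [← norm_star (1 - (r : H) * p)]
    simp [Quaternion.coe_commutes]
  have h2 := energy1 1 p (r : H)
  rw [norm_one, Quaternion.norm_coe, Real.norm_eq_abs, one_mul, Quaternion.star_coe,
    ← Quaternion.coe_commutes] at h2
  have h3 : 0 < (1 - |r| ^ 2) * (1 ^ 2 - ‖p‖ ^ 2) := by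
    apply mul_pos <;> nlinarith [abs_nonneg r, norm_nonneg p]
  have h4 : ‖p - (r : H)‖ < ‖1 - (r : H) * p‖ := by
    apply lt_of_pow_lt_pow_left₀ 2 (norm_nonneg _)
    linarith
  have h5 : 0 < ‖1 - (r : H) * p‖ := lt_of_le_of_lt (norm_nonneg _) h4
  have h6 : rho p (r : H) = ‖p - (r : H)‖ / ‖1 - (r : H) * p‖ := by
    rw [rho, mobiusM, norm_mul, norm_inv, h1, norm_sub_rev (r : H) p, div_eq_inv_mul]
  rw [h6]
  refine ⟨by positivity, (div_lt_one h5).2 h4, ?_⟩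
  field_simp

theorem hyp_est {u w : H} {d : ℝ} (hu : ‖u‖ ≤ 1) (hw : ‖w‖ ≤ 1) (hd0 : 0 ≤ d) (hd1 : d < 1)
    (h : ‖u - w‖ ≤ d * ‖1 - u * star w‖) : |‖u‖ - ‖w‖| ≤ d * (1 - ‖u‖ * ‖w‖) := by
  have h1 := energy1 1 u w
  rw [norm_one, one_mul] at h1
  have nu := norm_nonneg u
  have nw := norm_nonneg w
  have h2 : 1 - ‖u‖ * ‖w‖ ≤ ‖1 - u * star w‖ := by
    have := norm_sub_norm_le 1 (u * star w)
    rwa [norm_one, norm_mul, norm_star] at this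
  have h3 : 0 ≤ 1 - ‖u‖ * ‖w‖ := by nlinarith
  have h4 := pow_le_pow_left₀ (norm_nonneg _) h 2
  have h5 := pow_le_pow_left₀ h3 h2 2
  have h6 : 0 ≤ 1 - d ^ 2 := by nlinarith
  have h7 := mul_le_mul_of_nonneg_left h5 h6
  apply abs_le_of_sq_le_sq _ (by positivity)
  nlinarith

theorem schur_est {a : ℕ → H} (ha : Schur (mk a)) {r : ℝ} (hr : |r| < 1) {q : H}
    (hq : ‖q‖ < 1) :
    |‖evalC a q‖ - ‖evalC a (r : H)‖|
      ≤ rho q (r : H) * (1 - ‖evalC a q‖ * ‖evalC a (r : H)‖) := by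
  have hrn : ‖(r : H)‖ < 1 := by rwa [Quaternion.norm_coe]
  obtain ⟨h0, h1, h2⟩ := rho_props q hq hr
  apply hyp_est (schur_eval_le ha hq) (schur_eval_le ha hrn) h0 h1
  have h3 := schwarz_pick ha hr hq
  have h4 : 0 < ‖1 - (r : H) * q‖ := by
    rw [norm_pos_iff]
    intro h
    have : ‖(r : H) * q‖ = 1 := by rw [← sub_eq_zero.1 h, norm_one]
    rw [norm_mul] at this
    nlinarith [norm_nonneg q, norm_nonneg (r : H)]
  rw [h2] at h3
  apply le_of_mul_le_mul_left _ h4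
  linarith

theorem hdq_symm {a : ℕ → H} (ha : SelfMap a) {r s : ℝ} (hr : |r| < 1) (hs : |s| < 1) :
    ‖evalC (hdqC a (r : H)) (s : H)‖ = ‖evalC (hdqC a (s : H)) (r : H)‖ := by
  by_cases hrs : r = s
  · rw [hrs]
  have hS := selfMap_schur ha
  have hrn : ‖(r : H)‖ < 1 := by rwa [Quaternion.norm_coe]
  have hsn : ‖(s : H)‖ < 1 := by rwa [Quaternion.norm_coe]
  have h1 := (hdq_props hS hr (ha.2 _ hrn)).2 (s : H) hsn
  have h2 := (hdq_props hS hs (ha.2 _ hsn)).2 (r : H) hrn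
  rw [tw_comm _ _ _ (Quaternion.coe_commutes s _), ← evalC_eq] at h1
  rw [tw_comm _ _ _ (Quaternion.coe_commutes r _), ← evalC_eq] at h2
  have h3 := congrArg norm h1
  have h4 := congrArg norm h2
  simp only [norm_mul] at h3 h4
  set A := evalC a (r : H) with hA
  set B := evalC a (s : H) with hB
  have e1 : ‖1 - A * star B‖ = ‖1 - B * star A‖ := by
    rw [← norm_star (1 - A * star B)]; simp
  have e2 : ‖(r : H) - (s : H)‖ = ‖(s : H) - (r : H)‖ := norm_sub_rev _ _
  have e3 : ‖A - B‖ = ‖B - A‖ := norm_sub_rev _ _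
  have e4 : ‖1 - (s : H) * (r : H)‖ = ‖1 - (r : H) * (s : H)‖ := by
    rw [Quaternion.coe_commutes]
  rw [e1, e2, e3, e4, ← h3] at h4
  have p1 : ‖(s : H) - (r : H)‖ ≠ 0 := by
    rw [norm_ne_zero_iff, sub_ne_zero]
    intro h
    exact hrs (Quaternion.coe_injective h).symm
  have p2 : ‖1 - B * star A‖ ≠ 0 := by
    rw [norm_ne_zero_iff]
    intro h
    have : ‖B * star A‖ = 1 := by rw [← sub_eq_zero.1 h, norm_one]
    rw [norm_mul, norm_star] at this
    nlinarith [norm_nonneg A, norm_nonneg B, ha.2 _ hrn, ha.2 _ hsn]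
  exact (mul_left_cancel₀ p2 (mul_left_cancel₀ p1 h4)).symm

theorem fourPoint_aux (a : ℕ → H) (ha : SelfMap a)
    (r s : ℝ) (hr : |r| < 1) (hs : |s| < 1)
    (p q : H) (hp : ‖p‖ < 1) (hq : ‖q‖ < 1) :
    pdist 0 (evalC (hdqC a (r : H)) q) ≤
      pdist 0 (evalC (hdqC a (s : H)) p) + pdist p (r : H) + pdist q (s : H) := by
  have hS := selfMap_schur ha
  have hrn : ‖(r : H)‖ < 1 := by rwa [Quaternion.norm_coe]
  have hsn : ‖(s : H)‖ < 1 := by rwa [Quaternion.norm_coe]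
  have hg := (hdq_props hS hr (ha.2 _ hrn)).1
  have hg' := (hdq_props hS hs (ha.2 _ hsn)).1
  have E1 := schur_est hg hs hq
  have E2 := schur_est hg' hr hp
  rw [hdq_symm ha hr hs] at E1
  have b1 := schur_eval_le hg hq
  have b2 := schur_eval_le hg' hrn
  have b3 := schur_eval_le hg' hp
  obtain ⟨c1, c2, -⟩ := rho_props q hq hs
  obtain ⟨d1, d2, -⟩ := rho_props p hp hr
  rw [pdist_zero, pdist_zero]
  have r1 : pdist p (r : H) = art (rho p (r : H)) := rfl
  have r2 : pdist q (s : H) = art (rho q (s : H)) := rfl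
  rw [r1, r2]
  have n1 := norm_nonneg (evalC (hdqC a (r : H)) q)
  have n2 := norm_nonneg (evalC (hdqC a (s : H)) (r : H))
  have n3 := norm_nonneg (evalC (hdqC a (s : H)) p)
  set α := ‖evalC (hdqC a (r : H)) q‖
  set β := ‖evalC (hdqC a (s : H)) (r : H)‖
  set γ := ‖evalC (hdqC a (s : H)) p‖
  obtain ⟨E1a, E1b⟩ := abs_le.1 E1
  obtain ⟨E2a, E2b⟩ := abs_le.1 E2
  rcases b1.eq_or_lt with h | h
  · have : art α = 0 := by rw [h]; simp [art]
    rw [this]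
    have := art_nonneg n3 b3
    have := art_nonneg c1 c2.le
    have := art_nonneg d1 d2.le
    linarith
  have hβ : β < 1 := by
    rcases b2.eq_or_lt with h' | h'
    · exfalso; rw [h'] at E1a; nlinarith
    · exact h'
  have hγ : γ < 1 := by
    rcases b3.eq_or_lt with h' | h'
    · exfalso; rw [h'] at E2b; nlinarith
    · exact h'
  have F1 := art_le n1 h n2 hβ c1 c2 E1b
  have F2 := art_le n2 hβ n3 hγ d1 d2 (by linarith)
  linarith

end Aux4

/-- Four-point estimate: for real `r, s ∈ (−1,1)` and `p, q ∈ 𝔹`, and `f` a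
slice regular self-map of `𝔹` which is not a regular Möbius transformation
times a unimodular constant,
`δ(0, f⋆_r(q)) ≤ δ(0, f⋆_s(p)) + δ(p, r) + δ(q, s)`. -/
theorem fourPoint_estimate (a : ℕ → H) (ha : SelfMap a) (hnot : ¬ IsBlaschke a 1)
    (r s : ℝ) (hr1 : -1 < r) (hr2 : r < 1) (hs1 : -1 < s) (hs2 : s < 1)
    (p q : H) (hp : ‖p‖ < 1) (hq : ‖q‖ < 1) :
    pdist 0 (evalC (hdqC a (r : H)) q) ≤
      pdist 0 (evalC (hdqC a (s : H)) p) + pdist p (r : H) + pdist q (s : H) := by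
  exact fourPoint_aux a ha r s (abs_lt.2 ⟨hr1, hr2⟩) (abs_lt.2 ⟨hs1, hs2⟩) p q hp hq

end QPaper
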